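/- arXiv:2501.17750 — 4 statements merged into one kernel-verified Lean document; each statement's English description precedes it below -/
import Mathlib

section
/- Let f : [0,1] → [0,1] be a convex function. Let P_1, …, P_n and P'_1, …, P'_n be probability measures on a measurable space Ω such that P_i and P'_i are f-indistinguishable for every i (i.e., T_{P_i,P'_i}(x) ≥ f(x) for all x ∈ [0,1]). Then for any nonnegative weights c_1, …, c_n with c_1 + ⋯ + c_n = 1, the mixtures Σ_i c_i P_i and Σ_i c_i P'_i are also f-indistinguishable: T_{Σ c_i P_i, Σ c_i P'_i}(x) ≥ f(x) for all x ∈ [0,1]. -/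
open MeasureTheory
open scoped ENNReal NNReal

/-- The trade-off function `T_{P,P'}`: infimum of type II errors over all randomized
tests with type I error at most `α`. -/
noncomputable def tradeOff {Ω : Type*} [MeasurableSpace Ω] (P P' : Measure Ω) (α : ℝ) : ℝ :=
  sInf {β : ℝ | ∃ φ : Ω → ℝ, Measurable φ ∧ (∀ ω, φ ω ∈ Set.Icc (0:ℝ) 1) ∧
    (∫ ω, φ ω ∂P) ≤ α ∧ β = 1 - ∫ ω, φ ω ∂P'}

/-- `P` and `P'` are `f`-indistinguishable. -/
def Indist {Ω : Type*} [MeasurableSpace Ω] (f : ℝ → ℝ) (P P' : Measure Ω) : Prop :=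
  ∀ x ∈ Set.Icc (0:ℝ) 1, f x ≤ tradeOff P P' x

theorem tradeOff_le {Ω : Type*} [MeasurableSpace Ω] (P P' : Measure Ω) [IsProbabilityMeasure P']
    {α : ℝ} {φ : Ω → ℝ} (hφ : Measurable φ) (hφ_mem : ∀ ω, φ ω ∈ Set.Icc (0:ℝ) 1)
    (hα : ∫ ω, φ ω ∂P ≤ α) : tradeOff P P' α ≤ 1 - ∫ ω, φ ω ∂P' := by
  refine csInf_le ⟨0, ?_⟩ ⟨φ, hφ, hφ_mem, hα, rfl⟩
  rintro _ ⟨ψ, hψ, hψ_mem, -, rfl⟩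
  have hint : Integrable ψ P' :=
    Integrable.of_mem_Icc 0 1 hψ.aemeasurable (ae_of_all _ hψ_mem)
  have h := integral_mono hint (integrable_const (1:ℝ)) fun ω => (hψ_mem ω).2
  simp at h
  linarith

theorem integral_mixture {Ω ι : Type*} [MeasurableSpace Ω] [Fintype ι] (P : ι → Measure Ω)
    (c : ι → ℝ≥0) {φ : Ω → ℝ} (hφ : ∀ i, Integrable φ (P i)) :
    ∫ ω, φ ω ∂(∑ i, (c i : ℝ≥0∞) • P i) = ∑ i, (c i : ℝ) * ∫ ω, φ ω ∂(P i) := by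
  rw [integral_finsetSum_measure fun i _ => (hφ i).smul_measure ENNReal.coe_ne_top]
  simp [NNReal.smul_def]

theorem mixture_indist {Ω : Type*} [MeasurableSpace Ω] {n : ℕ}
    (f : ℝ → ℝ) (hf : ConvexOn ℝ (Set.Icc (0:ℝ) 1) f)
    (hf_mem : ∀ x ∈ Set.Icc (0:ℝ) 1, f x ∈ Set.Icc (0:ℝ) 1)
    (P P' : Fin n → Measure Ω)
    (hP : ∀ i, IsProbabilityMeasure (P i)) (hP' : ∀ i, IsProbabilityMeasure (P' i))
    (hind : ∀ i, Indist f (P i) (P' i))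
    (c : Fin n → ℝ≥0) (hc : ∑ i, c i = 1) :
    Indist f (∑ i, (c i : ℝ≥0∞) • P i) (∑ i, (c i : ℝ≥0∞) • P' i) := by
  intro x hx
  refine le_csInf ⟨_, 0, measurable_const, by simp, by simpa using hx.1, rfl⟩ ?_
  rintro _ ⟨φ, hφ, hφ_mem, hα, rfl⟩
  have hint (μ : Measure Ω) [IsProbabilityMeasure μ] : Integrable φ μ :=
    Integrable.of_mem_Icc 0 1 hφ.aemeasurable (ae_of_all _ hφ_mem)
  rw [integral_mixture P c fun i => hint (P i)] at hα
  rw [integral_mixture P' c fun i => hint (P' i)]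
  have hc' : ∑ i, (c i : ℝ) = 1 := by exact_mod_cast hc
  set a : Fin n → ℝ := fun i => ∫ ω, φ ω ∂(P i) with ha
  have ha_mem (i : Fin n) : a i ∈ Set.Icc (0:ℝ) 1 := by
    refine ⟨integral_nonneg fun ω => (hφ_mem ω).1, ?_⟩
    have h := integral_mono (hint (P i)) (integrable_const (1:ℝ)) fun ω => (hφ_mem ω).2
    simpa using h
  -- Raise all the levels `a i` proportionally towards `1` until their mixture is exactly `x`.
  obtain ⟨t, ht, hxt⟩ : ∃ t ∈ Set.Icc (0:ℝ) 1,
      x = ∑ i, (c i : ℝ) * a i + t * (1 - ∑ i, (c i : ℝ) * a i) := by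
    rcases (hα.trans hx.2).eq_or_lt with h | h
    · exact ⟨0, by simp, by linarith [hx.2]⟩
    · refine ⟨(x - ∑ i, (c i : ℝ) * a i) / (1 - ∑ i, (c i : ℝ) * a i),
        ⟨div_nonneg (by linarith) (by linarith), ?_⟩, ?_⟩
      · rw [div_le_one (by linarith)]
        linarith [hx.2]
      · rw [div_mul_cancel₀ _ (by linarith)]
        ring
  set y : Fin n → ℝ := fun i => a i + t * (1 - a i) with hy
  have hay (i : Fin n) : a i ≤ y i := by
    have := mul_nonneg ht.1 (sub_nonneg.2 (ha_mem i).2)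
    simp only [hy]
    linarith
  have hy_mem (i : Fin n) : y i ∈ Set.Icc (0:ℝ) 1 := by
    refine ⟨(ha_mem i).1.trans (hay i), ?_⟩
    have := mul_nonneg (sub_nonneg.2 ht.2) (sub_nonneg.2 (ha_mem i).2)
    simp only [hy]
    linarith
  have hxy : x = ∑ i, (c i : ℝ) * y i := by
    have h (i : Fin n) : (c i : ℝ) * y i = c i * a i + t * (c i - c i * a i) := by
      simp only [hy]
      ring
    simp only [h, Finset.sum_add_distrib, ← Finset.mul_sum, Finset.sum_sub_distrib, hc']
    exact hxt
  calc f x ≤ ∑ i, (c i : ℝ) * f (y i) := by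
        rw [hxy]
        simpa using hf.map_sum_le (fun i _ => (c i).2) hc' (fun i _ => hy_mem i)
    _ ≤ ∑ i, (c i : ℝ) * (1 - ∫ ω, φ ω ∂(P' i)) := by
        gcongr with i
        exact (hind i _ (hy_mem i)).trans (tradeOff_le (P i) (P' i) hφ hφ_mem (hay i))
    _ = 1 - ∑ i, (c i : ℝ) * ∫ ω, φ ω ∂(P' i) := by
        simp only [mul_sub, mul_one, Finset.sum_sub_distrib, hc']
end

section
/- Let P, P' be probability measures on a measurable space Ω and g : Ω → Ω' a measurable map into another measurable space. Then for every x ∈ [0,1], T_{g_*P, g_*P'}(x) ≥ T_{P,P'}(x), where g_*P denotes the pushforward measure. Consequently, if P and P' are f-indistinguishable for some f : [0,1] → [0,1], then so are g_*P and g_*P'. -/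
open MeasureTheory
open scoped ENNReal NNReal

/-- Post-processing can only increase the trade-off function: the pushforwards of `P, P'`
along a measurable map are at least as hard to distinguish, hence `f`-indistinguishability
is preserved. -/
theorem tradeOff_map_ge {Ω Ω' : Type*} [MeasurableSpace Ω] [MeasurableSpace Ω']
    (P P' : Measure Ω) (hP : IsProbabilityMeasure P) (hP' : IsProbabilityMeasure P')
    (g : Ω → Ω') (hg : Measurable g) :
    (∀ x ∈ Set.Icc (0:ℝ) 1, tradeOff P P' x ≤ tradeOff (P.map g) (P'.map g) x) ∧
    (∀ f : ℝ → ℝ, Indist f P P' → Indist f (P.map g) (P'.map g)) := by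
  have key : ∀ x ∈ Set.Icc (0:ℝ) 1, tradeOff P P' x ≤ tradeOff (P.map g) (P'.map g) x := by
    intro x hx
    refine csInf_le_csInf ⟨0, ?_⟩ ⟨1, fun _ => 0, measurable_const, by simp, ?_, by simp⟩ ?_
    · rintro β ⟨φ, -, hφ, -, rfl⟩
      have h : ∫ ω, φ ω ∂P' ≤ ∫ _, (1:ℝ) ∂P' :=
        integral_mono_of_nonneg (.of_forall fun ω => (hφ ω).1) (integrable_const _)
          (.of_forall fun ω => (hφ ω).2)
      simpa using h
    · simpa using hx.1
    · rintro β ⟨φ, hφm, hφ, hα, rfl⟩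
      rw [integral_map hg.aemeasurable hφm.aestronglyMeasurable] at hα ⊢
      exact ⟨φ ∘ g, hφm.comp hg, fun ω => hφ (g ω), hα, rfl⟩
  exact ⟨key, fun f hf x hx => (hf x hx).trans (key x hx)⟩
end

section
/- Define F(α, β, p) = h(pβ + (1−p)(1−α)) − p·h(β) − (1−p)·h(1−α) for α, β, p ∈ (0,1), where h is the binary entropy function (base 2). Fix α, p ∈ (0,1). Then F(α, ·, p) is nonincreasing in β on the set {β ∈ (0,1) : α + β ≤ 1}; that is, if 0 < β ≤ β' < 1 and α + β' ≤ 1, then F(α, β', p) ≤ F(α, β, p). -/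
/-- Binary entropy function (base 2), with the convention `h 0 = h 1 = 0`. -/
noncomputable def binH (x : ℝ) : ℝ :=
  -(x * Real.logb 2 x) - (1 - x) * Real.logb 2 (1 - x)

/-- `F(α, β, p) = h(pβ + (1−p)(1−α)) − p·h(β) − (1−p)·h(1−α)`. -/
noncomputable def Fent (α β p : ℝ) : ℝ :=
  binH (p * β + (1 - p) * (1 - α)) - p * binH β - (1 - p) * binH (1 - α)

theorem binH_eq_binEntropy_div (x : ℝ) : binH x = Real.binEntropy x / Real.log 2 := by
  simp only [binH, Real.binEntropy, Real.logb, Real.log_inv]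
  ring

/-- The Jensen gap of the binary entropy between `β` and `c` is nonincreasing in `β ≤ c`; the term
independent of `β` is left out. -/
theorem antitoneOn_binEntropy_mix_sub {p c : ℝ} (hp : p ∈ Set.Ioo (0:ℝ) 1) (hc : c < 1) :
    AntitoneOn (fun β => Real.binEntropy (p * β + (1 - p) * c) - p * Real.binEntropy β)
      (Set.Ioc 0 c) := by
  obtain ⟨hp0, hp1⟩ := hp
  have hderiv : ∀ β ∈ Set.Ioo (0:ℝ) c,
      HasDerivAt (fun β => Real.binEntropy (p * β + (1 - p) * c) - p * Real.binEntropy β)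
        ((Real.log (1 - (p * β + (1 - p) * c)) - Real.log (p * β + (1 - p) * c)) * p
          - p * (Real.log (1 - β) - Real.log β)) β := by
    rintro β ⟨h0, hβc⟩
    have hm0 : 0 < p * β + (1 - p) * c := by nlinarith
    have hm1 : p * β + (1 - p) * c < 1 := by nlinarith
    have hlin : HasDerivAt (fun β : ℝ => p * β + (1 - p) * c) p β := by
      simpa using ((hasDerivAt_id β).const_mul p).add_const ((1 - p) * c)
    exact ((Real.hasDerivAt_binEntropy hm0.ne' hm1.ne).comp β hlin).sub
      ((Real.hasDerivAt_binEntropy h0.ne' (hβc.trans hc).ne).const_mul p)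
  refine antitoneOn_of_deriv_nonpos (convex_Ioc 0 c) ?_ ?_ ?_
  · exact Continuous.continuousOn (by fun_prop)
  · rw [interior_Ioc]
    exact fun β hβ => (hderiv β hβ).differentiableAt.differentiableWithinAt
  · rw [interior_Ioc]
    intro β hβ
    rw [(hderiv β hβ).deriv]
    obtain ⟨h0, hβc⟩ := hβ
    have hβm : β ≤ p * β + (1 - p) * c := by nlinarith
    have hm1 : p * β + (1 - p) * c < 1 := by nlinarith
    have hlog := Real.log_le_log h0 hβm
    have hlog_one_sub := Real.log_le_log (sub_pos.2 hm1) (sub_le_sub_left hβm 1)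
    nlinarith


/-- For fixed `α, p ∈ (0,1)`, `F(α, ·, p)` is nonincreasing in `β` on
`{β ∈ (0,1) : α + β ≤ 1}`. -/
theorem Fent_antitone_beta (α p : ℝ) (hα : α ∈ Set.Ioo (0:ℝ) 1) (hp : p ∈ Set.Ioo (0:ℝ) 1)
    (β β' : ℝ) (hβ : 0 < β) (hββ' : β ≤ β') (hβ' : β' < 1) (hsum : α + β' ≤ 1) :
    Fent α β' p ≤ Fent α β p := by
  have h := antitoneOn_binEntropy_mix_sub hp (c := 1 - α) (by linarith [hα.1])
    (a := β) ⟨hβ, by linarith⟩ (b := β') ⟨by linarith, by linarith⟩ hββ'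
  simp only [Fent, binH_eq_binEntropy_div, ← mul_div_assoc, ← sub_div]
  exact div_le_div_of_nonneg_right (sub_le_sub_right h _) (Real.log_pos one_lt_two).le
end

section
/- Let P and P' be probability measures on a measurable space Ω, let ε ≥ 0 and δ ∈ [0,1], and suppose that for every measurable set S ⊆ Ω, P(S) ≤ e^ε·P'(S) + δ and P'(S) ≤ e^ε·P(S) + δ. Then P and P' are f_{ε,δ}-indistinguishable, i.e., T_{P,P'}(x) ≥ f_{ε,δ}(x) for all x ∈ [0,1], where f_{ε,δ}(x) = max(0, 1 − δ − e^ε·x, e^{−ε}(1 − δ − x)). -/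
open MeasureTheory
open scoped ENNReal

/-- The trade-off function of `(ε,δ)`-DP:
`f_{ε,δ}(x) = max(0, 1 − δ − e^ε·x, e^{−ε}(1 − δ − x))`. -/
noncomputable def fEpsDelta (ε δ x : ℝ) : ℝ :=
  max 0 (max (1 - δ - Real.exp ε * x) (Real.exp (-ε) * (1 - δ - x)))

/-- An inequality `μ S ≤ c * ν S + δ` between finite measures that holds for all measurable sets
extends to all measurable functions with values in `[0, 1]`. -/
theorem integral_le_mul_integral_add_of_forall_measure_le {Ω : Type*} [MeasurableSpace Ω]
    {μ ν : Measure Ω} [IsFiniteMeasure μ] [IsFiniteMeasure ν] {c δ : ℝ}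
    (h : ∀ S, MeasurableSet S → μ.real S ≤ c * ν.real S + δ)
    {φ : Ω → ℝ} (hφ : Measurable φ) (hφ01 : ∀ ω, φ ω ∈ Set.Icc (0 : ℝ) 1) :
    ∫ ω, φ ω ∂μ ≤ c * ∫ ω, φ ω ∂ν + δ := by
  have integrable (ρ : Measure Ω) [IsFiniteMeasure ρ] : Integrable φ ρ :=
    .of_mem_Icc 0 1 hφ.aemeasurable (.of_forall hφ01)
  have layer_cake (ρ : Measure Ω) [IsFiniteMeasure ρ] :
      ∫ ω, φ ω ∂ρ = ∫ t in (0 : ℝ)..1, ρ.real {ω | t ≤ φ ω} := by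
    rw [intervalIntegral.integral_of_le zero_le_one]
    exact (integrable ρ).integral_eq_integral_Ioc_meas_le
      (.of_forall fun ω => (hφ01 ω).1) (.of_forall fun ω => (hφ01 ω).2)
  have level_integrable (ρ : Measure Ω) [IsFiniteMeasure ρ] :
      IntervalIntegrable (fun t => ρ.real {ω | t ≤ φ ω}) volume 0 1 :=
    Antitone.intervalIntegrable fun _ _ hst => measureReal_mono fun _ hω => hst.trans hω
  calc ∫ ω, φ ω ∂μ = ∫ t in (0 : ℝ)..1, μ.real {ω | t ≤ φ ω} := layer_cake μ
    _ ≤ ∫ t in (0 : ℝ)..1, (c * ν.real {ω | t ≤ φ ω} + δ) :=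
      intervalIntegral.integral_mono_on zero_le_one (level_integrable μ)
        (((level_integrable ν).const_mul c).add intervalIntegrable_const)
        fun _ _ => h _ (measurableSet_le measurable_const hφ)
    _ = c * ∫ ω, φ ω ∂ν + δ := by
      rw [intervalIntegral.integral_add ((level_integrable ν).const_mul c)
        intervalIntegrable_const, intervalIntegral.integral_const_mul, ← layer_cake ν]
      simp

/-- If the `(ε,δ)`-DP inequalities hold between `P` and `P'`, then `P` and `P'` are
`f_{ε,δ}`-indistinguishable. -/
theorem dp_implies_fEpsDelta_indist {Ω : Type*} [MeasurableSpace Ω]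
    (P P' : Measure Ω) [IsProbabilityMeasure P] [IsProbabilityMeasure P']
    (ε : ℝ) (hε : 0 ≤ ε) (δ : ℝ) (hδ : δ ∈ Set.Icc (0:ℝ) 1)
    (hdp : ∀ S : Set Ω, MeasurableSet S →
        (P S).toReal ≤ Real.exp ε * (P' S).toReal + δ ∧
        (P' S).toReal ≤ Real.exp ε * (P S).toReal + δ) :
    ∀ x ∈ Set.Icc (0:ℝ) 1, fEpsDelta ε δ x ≤ tradeOff P P' x := by
  rintro x ⟨hx, -⟩
  refine le_csInf ⟨1, fun _ => 0, measurable_const, by simp, by simpa using hx, by simp⟩ ?_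
  rintro _ ⟨φ, hφ, hφ01, hα, rfl⟩
  have integrable (ρ : Measure Ω) [IsFiniteMeasure ρ] : Integrable φ ρ :=
    .of_mem_Icc 0 1 hφ.aemeasurable (.of_forall hφ01)
  have integral_compl (ρ : Measure Ω) [IsProbabilityMeasure ρ] :
      ∫ ω, (1 - φ ω) ∂ρ = 1 - ∫ ω, φ ω ∂ρ := by
    rw [integral_sub (integrable_const 1) (integrable ρ)]
    simp
  have hcompl01 (ω : Ω) : 1 - φ ω ∈ Set.Icc (0 : ℝ) 1 :=
    ⟨sub_nonneg.2 (hφ01 ω).2, sub_le_self _ (hφ01 ω).1⟩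
  have hP' := integral_le_mul_integral_add_of_forall_measure_le (fun S hS => (hdp S hS).2) hφ hφ01
  have hP := integral_le_mul_integral_add_of_forall_measure_le (fun S hS => (hdp S hS).1)
    (φ := fun ω => 1 - φ ω) (measurable_const.sub hφ) hcompl01
  rw [integral_compl, integral_compl] at hP
  refine max_le ?_ (max_le ?_ ?_)
  · rw [← integral_compl]
    exact integral_nonneg fun ω => (hcompl01 ω).1
  · linarith [mul_le_mul_of_nonneg_left hα (Real.exp_pos ε).le]
  · rw [Real.exp_neg, inv_mul_le_iff₀ (Real.exp_pos ε)]
    linarith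
end
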